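/- arXiv:2010.08812 — 2 statements merged into one kernel-verified Lean document; each statement's English description precedes it below -/
import Mathlib

section
/- A subset A of a perfect Polish space X is countably perfectly meager in X if and only if for every continuous bijection f : ℕ^ℕ → X there exist closed sets F_n in X such that A ⊆ ⋃_n F_n and f⁻¹(F_n) is nowhere dense in ℕ^ℕ for each n. -/
open Set

/-- An `Fσ` set: a countable union of closed sets. -/
def IsFsigma {X : Type*} [TopologicalSpace X] (F : Set X) : Prop :=
  ∃ s : ℕ → Set X, (∀ n, IsClosed (s n)) ∧ F = ⋃ n, s n

/-- A perfect set in the classical sense: nonempty, closed, without isolated points. -/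
def PerfectSet {X : Type*} [TopologicalSpace X] (P : Set X) : Prop :=
  Perfect P ∧ P.Nonempty

/-- A Cantor set: a subset homeomorphic to the Cantor space `2^ℕ`
(hence nonempty and compact). -/
def IsCantorSet {X : Type*} [TopologicalSpace X] (K : Set X) : Prop :=
  Nonempty ((ℕ → Bool) ≃ₜ K)

/-- `F` is meager relative to the subspace `P`. -/
def MeagerIn {X : Type*} [TopologicalSpace X] (F P : Set X) : Prop :=
  IsMeagre ((↑) ⁻¹' F : Set P)

/-- `A` is countably perfectly meager in `X`. -/
def CPM {X : Type*} [TopologicalSpace X] (A : Set X) : Prop :=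
  ∀ P : ℕ → Set X, (∀ n, PerfectSet (P n)) →
    ∃ F : Set X, IsFsigma F ∧ A ⊆ F ∧ ∀ n, MeagerIn F (P n)

lemma fs_inter {X : Type*} [TopologicalSpace X] {E F : Set X} (hE : IsFsigma E)
    (hF : IsFsigma F) : IsFsigma (E ∩ F) := by
  obtain ⟨s, hs, rfl⟩ := hE
  obtain ⟨t, ht, rfl⟩ := hF
  refine ⟨fun n => s n.unpair.1 ∩ t n.unpair.2, fun n => (hs _).inter (ht _), ?_⟩
  ext x
  simp only [mem_inter_iff, mem_iUnion]
  constructor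
  · rintro ⟨⟨a, ha⟩, ⟨b, hb⟩⟩
    exact ⟨Nat.pair a b, by simpa using ⟨ha, hb⟩⟩
  · rintro ⟨n, h1, h2⟩
    exact ⟨⟨_, h1⟩, ⟨_, h2⟩⟩

lemma fs_closed {X : Type*} [TopologicalSpace X] {E : Set X} (hE : IsClosed E) : IsFsigma E :=
  ⟨fun _ => E, fun _ => hE, by simp [iUnion_const]⟩

lemma fs_open {X : Type*} [MetricSpace X] {E : Set X} (hE : IsOpen E) : IsFsigma E := by
  obtain ⟨F, hF, -, h, -⟩ := hE.exists_iUnion_isClosed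
  exact ⟨F, hF, h.symm⟩

lemma fs_split0 {X : Type*} [MetricSpace X] [SecondCountableTopology X] [Nonempty X]
    {E : Set X} (hE : IsFsigma E) (ε : ENNReal) (hε : 0 < ε) :
    ∃ D : ℕ → Set X, (∀ n, IsFsigma (D n)) ∧ (∀ n, Metric.ediam (D n) ≤ ε) ∧
      (∀ n, closure (D n) ⊆ E) ∧ Pairwise (Function.onFun Disjoint D) ∧ E = ⋃ n, D n := by
  obtain ⟨s, hs, rfl⟩ := hE
  have hε2 : 0 < ε / 2 := ENNReal.div_pos hε.ne' (by simp)
  set T : ℕ → Set X := fun n => s n.unpair.1 ∩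
    Metric.closedEBall (TopologicalSpace.denseSeq X n.unpair.2) (ε / 2) with hT
  have hTc : ∀ n, IsClosed (T n) := fun n => (hs _).inter Metric.isClosed_closedEBall
  have hTU : ⋃ n, T n = ⋃ n, s n := by
    ext x
    simp only [mem_iUnion]
    constructor
    · rintro ⟨n, h1, h2⟩
      exact ⟨_, h1⟩
    · rintro ⟨a, ha⟩
      obtain ⟨b, hb⟩ := (TopologicalSpace.denseRange_denseSeq X).exists_mem_open
        (Metric.isOpen_eball (x := x) (ε := ε / 2)) ⟨x, Metric.mem_eball_self hε2⟩
      refine ⟨Nat.pair a b, ?_⟩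
      simp only [hT, Nat.unpair_pair]
      refine ⟨ha, ?_⟩
      rw [Metric.mem_closedEBall, edist_comm]
      exact (Metric.mem_eball.1 hb).le
  have hsub : ∀ n, disjointed T n ⊆ T n := fun n => disjointed_subset T n
  refine ⟨disjointed T, ?_, ?_, ?_, disjoint_disjointed T, ?_⟩
  · intro n
    rw [disjointed_eq_inter_compl]
    refine fs_inter (fs_closed (hTc n)) (fs_open ?_)
    exact (Set.finite_Iio n).isOpen_biInter (fun i _ => (hTc i).isOpen_compl)
  · intro n
    refine (Metric.ediam_mono ((hsub n).trans inter_subset_right)).trans ?_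
    refine Metric.ediam_closedEBall_le.trans ?_
    rw [ENNReal.mul_div_cancel (by simp) (by simp)]
  · intro n
    refine (closure_minimal (hsub n) (hTc n)).trans ?_
    exact inter_subset_left.trans (subset_iUnion s _)
  · rw [iUnion_disjointed, hTU]

lemma exists_cond {X : Type*} [TopologicalSpace X] [SecondCountableTopology X] {E : Set X}
    (hE : ¬ E.Countable) : ∃ p ∈ E, ∀ U ∈ nhds p, ¬ (E ∩ U).Countable := by
  by_contra! h
  choose! U hU hc using h
  obtain ⟨t, hts, htc, hcov⟩ := TopologicalSpace.countable_cover_nhdsWithin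
    (f := U) (s := E) (fun x hx => mem_nhdsWithin_of_mem_nhds (hU x hx))
  apply hE
  refine (htc.biUnion (fun x hx => hc x (hts hx))).mono ?_
  intro y hy
  have := hcov hy
  simp only [mem_iUnion] at this ⊢
  obtain ⟨i, hi, h⟩ := this
  exact ⟨i, hi, hy, h⟩

lemma fs_split {X : Type*} [MetricSpace X] [SecondCountableTopology X]
    {E : Set X} (hE : IsFsigma E) (hEu : ¬ E.Countable) (ε : ENNReal) (hε : 0 < ε) :
    ∃ D : ℕ → Set X, (∀ n, IsFsigma (D n) ∧ ¬ (D n).Countable) ∧ (∀ n, Metric.ediam (D n) ≤ ε) ∧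
      (∀ n, closure (D n) ⊆ E) ∧ Pairwise (Function.onFun Disjoint D) ∧
      (E \ ⋃ n, D n).Countable := by
  obtain ⟨p, hp, hpc⟩ := exists_cond hEu
  have : Nonempty X := ⟨p⟩
  obtain ⟨D, h1, h2, h3, h4, h5⟩ := fs_split0 (fs_inter hE (fs_open (isOpen_compl_singleton (x := p)))) ε hε
  set S : Set ℕ := {n | ¬ (D n).Countable} with hS
  have hcount : (⋃ n ∈ Sᶜ, D n).Countable := by
    refine (Set.to_countable Sᶜ).biUnion ?_
    intro n hn
    simpa [hS] using hn
  have hinf : S.Infinite := by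
    intro hfin
    have hcl : IsClosed (⋃ n ∈ S, closure (D n)) :=
      hfin.isClosed_biUnion (fun _ _ => isClosed_closure)
    have hpn : p ∈ (⋃ n ∈ S, closure (D n))ᶜ := by
      simp only [mem_compl_iff, mem_iUnion, not_exists]
      intro n _ hn
      exact (h3 n hn).2 rfl
    apply hpc _ (hcl.isOpen_compl.mem_nhds hpn)
    refine (hcount.union (countable_singleton p)).mono ?_
    rintro x ⟨hx, hx2⟩
    by_cases hxp : x = p
    · right; exact hxp
    · left
      have : x ∈ ⋃ n, D n := h5 ▸ ⟨hx, hxp⟩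
      obtain ⟨n, hn⟩ := mem_iUnion.1 this
      refine mem_biUnion (x := n) ?_ hn
      intro hnS
      exact hx2 (mem_biUnion hnS (subset_closure hn))
  have := hinf.to_subtype
  let e := Nat.Subtype.orderIsoOfNat S
  refine ⟨fun n => D (e n), fun n => ⟨h1 _, (e n).2⟩, fun n => h2 _, fun n => (h3 _).trans inter_subset_left, ?_, ?_⟩
  · intro a b hab
    exact h4 (fun h => hab (e.injective (Subtype.ext h)))
  · refine (hcount.union (countable_singleton p)).mono ?_
    rintro x ⟨hx, hx2⟩
    by_cases hxp : x = p
    · right; exact hxp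
    · left
      have : x ∈ ⋃ n, D n := h5 ▸ ⟨hx, hxp⟩
      obtain ⟨n, hn⟩ := mem_iUnion.1 this
      refine mem_biUnion (x := n) ?_ hn
      intro hnS
      apply hx2
      refine mem_iUnion.2 ⟨e.symm ⟨n, hnS⟩, ?_⟩
      simpa using hn

lemma closed_param {X : Type*} [TopologicalSpace X] [PolishSpace X] {E : Set X}
    (hE : IsClosed E) (hEu : ¬ E.Countable) :
    ∃ f : (ℕ → ℕ) → X, Continuous f ∧ Function.Injective f ∧ range f ⊆ E ∧
      (E \ range f).Countable := by
  let := TopologicalSpace.upgradeIsCompletelyMetrizable X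
  let 𝓕 := {S : Set X // IsFsigma S ∧ ¬ S.Countable}
  have key : ∀ (S : 𝓕) (n : ℕ), ∃ D : ℕ → 𝓕, (∀ i, Metric.ediam (D i).1 ≤ (2⁻¹ : ENNReal) ^ n) ∧
      (∀ i, closure (D i).1 ⊆ S.1) ∧ Pairwise (fun i j => Disjoint (D i).1 (D j).1) ∧
      (S.1 \ ⋃ i, (D i).1).Countable := by
    intro S n
    obtain ⟨D, h1, h2, h3, h4, h5⟩ := fs_split S.2.1 S.2.2 ((2⁻¹ : ENNReal) ^ n)
      (ENNReal.pow_pos (by simp) n)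
    exact ⟨fun i => ⟨D i, h1 i⟩, h2, h3, h4, h5⟩
  choose D hD1 hD2 hD3 hD4 using key
  let A' : List ℕ → 𝓕 := fun l => List.rec ⟨E, fs_closed hE, hEu⟩ (fun a l S => D S l.length a) l
  let A : List ℕ → Set X := fun l => (A' l).1
  have hA' : ∀ a l, A' (a :: l) = D (A' l) l.length a := fun a l => rfl
  have hvan : CantorScheme.VanishingDiam A := by
    intro x
    rw [← Filter.tendsto_add_atTop_iff_nat 1]
    refine tendsto_of_tendsto_of_tendsto_of_le_of_le tendsto_const_nhds
      (ENNReal.tendsto_pow_atTop_nhds_zero_of_lt_one (r := 2⁻¹) (by simp)) (fun _ => zero_le) ?_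
    intro n
    have := hD1 (A' (PiNat.res x n)) (PiNat.res x n).length (x n)
    rw [PiNat.res_length] at this
    simpa [A, hA'] using this
  have hcl : CantorScheme.ClosureAntitone A := fun l a => hD2 _ _ _
  have hdis : CantorScheme.Disjoint A := fun l => hD3 _ _
  have hne : ∀ l, (A l).Nonempty := by
    intro l
    by_contra h
    rw [not_nonempty_iff_eq_empty] at h
    exact (A' l).2.2 (by rw [show (A' l).1 = ∅ from h]; exact countable_empty)
  have hdom := hcl.map_of_vanishingDiam hvan hne
  have hmem : ∀ x : ℕ → ℕ, x ∈ (CantorScheme.inducedMap A).1 := fun x => hdom ▸ mem_univ x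
  let f : (ℕ → ℕ) → X := fun x => (CantorScheme.inducedMap A).2 ⟨x, hmem x⟩
  have hf : ∀ x n, f x ∈ A (PiNat.res x n) := fun x n => CantorScheme.map_mem ⟨x, hmem x⟩ n
  refine ⟨f, ?_, ?_, ?_, ?_⟩
  · exact hvan.map_continuous.comp (continuous_id.subtype_mk _)
  · intro x y h
    exact congrArg Subtype.val (hdis.map_injective h)
  · rintro _ ⟨x, rfl⟩
    exact hf x 0
  · refine (countable_iUnion (fun l : List ℕ => hD4 (A' l) l.length)).mono ?_
    rintro y ⟨hy, hyf⟩
    by_contra hcon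
    simp only [mem_iUnion, mem_sdiff, not_exists, not_and, not_forall, not_not] at hcon
    have step : ∀ l : {l : List ℕ // y ∈ A l}, ∃ a, y ∈ A (a :: l.1) := fun l => hcon l.1 l.2
    choose g hg using step
    let L : ℕ → {l : List ℕ // y ∈ A l} := fun n =>
      Nat.rec ⟨[], hy⟩ (fun _ l => ⟨g l :: l.1, hg l⟩) n
    let x : ℕ → ℕ := fun n => g (L n)
    have hL : ∀ n, (L n).1 = PiNat.res x n := by
      intro n
      induction n with
      | zero => rfl
      | succ n ih =>
        rw [PiNat.res_succ, ← ih]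
    apply hyf
    refine ⟨x, ?_⟩
    refine eq_of_forall_dist_le (fun ε hε => ?_)
    obtain ⟨n, hn⟩ := hvan.dist_lt ε hε x
    exact (hn _ (hf x n) _ (hL n ▸ (L n).2)).le

lemma borel_param {X : Type*} [TopologicalSpace X] [PolishSpace X] [MeasurableSpace X]
    [BorelSpace X] {E : Set X} (hE : MeasurableSet E) (hEu : ¬ E.Countable) :
    ∃ f : (ℕ → ℕ) → X, Continuous f ∧ Function.Injective f ∧ range f ⊆ E ∧
      (E \ range f).Countable := by
  obtain ⟨t', ht', hp, hc, -⟩ := hE.isClopenable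
  obtain ⟨f, h1, h2, h3, h4⟩ := @closed_param X t' hp E hc hEu
  exact ⟨f, continuous_le_rng ht' h1, h2, h3, h4⟩

lemma big_split {X : Type*} [TopologicalSpace X] [PolishSpace X] [MeasurableSpace X]
    [BorelSpace X] (Q : ℕ → Set X) (hQ : ∀ n, MeasurableSet (Q n))
    (hQu : ∀ n, ¬ (Q n).Countable) :
    ∃ B ⊆ Q 0, MeasurableSet B ∧ ¬ B.Countable ∧ ∀ k, ¬ (Q k \ B).Countable := by
  have := (hQ 0).standardBorel
  have hR : ¬ Countable (ℝ × ℝ) := by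
    intro h
    have : Countable ℝ := Function.Injective.countable
      (f := fun x : ℝ => ((x, 0) : ℝ × ℝ)) (fun a b h => (Prod.mk.inj h).1)
    exact Cardinal.not_countable_real (Set.to_countable _)
  have h0 : ¬ Countable (Q 0) := fun h => hQu 0 (Set.countable_coe_iff.1 h)
  let e : Q 0 ≃ᵐ ℝ × ℝ := PolishSpace.measurableEquivOfNotCountable h0 hR
  let B : ℝ → Set X := fun a => Subtype.val '' (e ⁻¹' (Prod.fst ⁻¹' {a}))
  have hBm : ∀ a, MeasurableSet (B a) := fun a =>
    (hQ 0).subtype_image (e.measurable (measurable_fst (measurableSet_singleton a)))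
  have hBu : ∀ a, ¬ (B a).Countable := by
    intro a h
    have h2 : (e ⁻¹' (Prod.fst ⁻¹' {a})).Countable :=
      Set.countable_of_injective_of_countable_image (Subtype.val_injective.injOn) h
    apply Cardinal.not_countable_real
    have : Set.MapsTo (fun x : ℝ => e.symm (a, x)) univ (e ⁻¹' (Prod.fst ⁻¹' {a})) := by
      intro x _
      simp
    refine this.countable_of_injOn ?_ h2
    intro x _ y _ hxy
    simpa using hxy
  have hBd : ∀ a b, a ≠ b → Disjoint (B a) (B b) := by
    intro a b hab
    rw [Set.disjoint_left]
    rintro _ ⟨x, hx, rfl⟩ ⟨y, hy, hxy⟩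
    obtain rfl := Subtype.ext hxy
    simp only [mem_preimage, mem_singleton_iff] at hx hy
    exact hab (hx.symm.trans hy)
  have hbad : (⋃ k, {a | (Q k \ B a).Countable}).Countable := by
    refine countable_iUnion (fun k => Set.Subsingleton.countable ?_)
    intro a ha b hb
    by_contra hab
    apply hQu k
    refine (Set.Countable.union ha hb).mono ?_
    intro x hx
    by_cases h : x ∈ B a
    · exact Or.inr ⟨hx, Set.disjoint_left.1 (hBd a b hab) h⟩
    · exact Or.inl ⟨hx, h⟩
  obtain ⟨a, ha⟩ : ∃ a, a ∉ ⋃ k, {a | (Q k \ B a).Countable} := by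
    by_contra! h
    exact Cardinal.not_countable_real (hbad.mono (fun x _ => h x))
  refine ⟨B a, ?_, hBm a, hBu a, ?_⟩
  · rintro _ ⟨x, _, rfl⟩
    exact x.2
  · intro k hk
    exact ha (mem_iUnion.2 ⟨k, hk⟩)

lemma disj_refine {X : Type*} [TopologicalSpace X] [PolishSpace X] [MeasurableSpace X]
    [BorelSpace X] (Q : ℕ → Set X) (hQ : ∀ n, MeasurableSet (Q n))
    (hQu : ∀ n, ¬ (Q n).Countable) :
    ∃ B : ℕ → Set X, (∀ n, B n ⊆ Q n) ∧ (∀ n, MeasurableSet (B n)) ∧ (∀ n, ¬ (B n).Countable) ∧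
      Pairwise (Function.onFun Disjoint B) := by
  let St := {Q : ℕ → Set X // (∀ n, MeasurableSet (Q n)) ∧ ∀ n, ¬ (Q n).Countable}
  have key : ∀ S : St, ∃ B ⊆ S.1 0, MeasurableSet B ∧ ¬ B.Countable ∧ ∀ k, ¬ (S.1 k \ B).Countable :=
    fun S => big_split S.1 S.2.1 S.2.2
  choose β h1 h2 h3 h4 using key
  let step : St → St := fun S =>
    ⟨fun k => S.1 (k + 1) \ β S, fun k => (S.2.1 _).diff (h2 S), fun k => h4 S _⟩
  let s : ℕ → St := fun n => Nat.rec ⟨Q, hQ, hQu⟩ (fun _ S => step S) n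
  have hs : ∀ n k, (s (n + 1)).1 k = (s n).1 (k + 1) \ β (s n) := fun n k => rfl
  have hsub : ∀ n k, (s n).1 k ⊆ Q (n + k) := by
    intro n
    induction n with
    | zero => intro k; rw [Nat.zero_add]; exact Subset.rfl
    | succ n ih =>
      intro k
      rw [hs, show n + 1 + k = n + (k + 1) by omega]
      exact sdiff_subset.trans (ih _)
  have hdis : ∀ n j k, Disjoint (β (s n)) ((s (n + 1 + j)).1 k) := by
    intro n j
    induction j with
    | zero => intro k; exact disjoint_sdiff_right
    | succ j ih =>
      intro k
      rw [show n + 1 + (j + 1) = (n + 1 + j) + 1 by omega, hs]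
      exact (ih _).mono_right sdiff_subset
  have hlt : ∀ a b, a < b → Disjoint (β (s a)) (β (s b)) := by
    intro a b hab
    obtain ⟨j, rfl⟩ := Nat.exists_eq_add_of_le (Nat.succ_le_of_lt hab)
    exact (hdis a j 0).mono_right (h1 _)
  refine ⟨fun n => β (s n), fun n => (h1 _).trans (hsub n 0), fun n => h2 _, fun n => h3 _, ?_⟩
  intro a b hab
  rcases lt_or_gt_of_ne hab with h | h
  · exact hlt a b h
  · exact (hlt b a h).symm

lemma partition_refine {X : Type*} [TopologicalSpace X] [PolishSpace X] [MeasurableSpace X]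
    [BorelSpace X] (Q : ℕ → Set X) (hQ : ∀ n, MeasurableSet (Q n))
    (hQu : ∀ n, ¬ (Q n).Countable) :
    ∃ B : ℕ → Set X, (∀ n, B (n + 1) ⊆ Q n) ∧ (∀ n, MeasurableSet (B n)) ∧
      (∀ n, ¬ (B n).Countable) ∧ Pairwise (Function.onFun Disjoint B) ∧ ⋃ n, B n = univ := by
  let Q' : ℕ → Set X := fun n => Nat.casesOn n univ Q
  obtain ⟨C, h1, h2, h3, h4⟩ := disj_refine Q'
    (by rintro (_ | n); exacts [MeasurableSet.univ, hQ n])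
    (by rintro (_ | n); exacts [fun h => hQu 0 (h.mono (subset_univ _)), hQu n])
  let B : ℕ → Set X := fun n => Nat.casesOn n (⋃ k, C (k + 1))ᶜ (fun k => C (k + 1))
  have hB0 : B 0 = (⋃ k, C (k + 1))ᶜ := rfl
  have hBs : ∀ n, B (n + 1) = C (n + 1) := fun n => rfl
  refine ⟨B, fun n => h1 (n + 1), ?_, ?_, ?_, ?_⟩
  · rintro (_ | n)
    · exact (MeasurableSet.iUnion fun k => h2 _).compl
    · exact h2 _
  · rintro (_ | n)
    · intro h
      apply h3 0
      refine h.mono ?_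
      intro x hx
      rw [hB0]
      simp only [mem_compl_iff, mem_iUnion, not_exists]
      intro k hk
      exact Set.disjoint_left.1 (h4 (Nat.succ_ne_zero k).symm) hx hk
    · exact h3 _
  · have h0 : ∀ n, Disjoint (B 0) (B (n + 1)) := by
      intro n
      rw [hB0, hBs]
      exact disjoint_compl_left.mono_right (subset_iUnion (fun k => C (k + 1)) n)
    rintro (_ | a) (_ | b) hab
    · exact absurd rfl hab
    · exact h0 b
    · exact (h0 a).symm
    · exact h4 hab
  · rw [eq_univ_iff_forall]
    intro x
    by_cases h : x ∈ ⋃ k, C (k + 1)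
    · obtain ⟨k, hk⟩ := mem_iUnion.1 h
      exact mem_iUnion.2 ⟨k + 1, hk⟩
    · exact mem_iUnion.2 ⟨0, h⟩

lemma absorb {X : Type*} [TopologicalSpace X] (d : X) (g : ℕ → (ℕ → ℕ) → X)
    (hc : ∀ j, Continuous (g j)) (hi : ∀ j, Function.Injective (g j))
    (hd : ∀ i j, i ≠ j → Disjoint (range (g i)) (range (g j)))
    (hdg : ∀ j, d ∉ range (g j))
    (hlim : ∀ U ∈ nhds d, ∃ J, ∀ j ≥ J, range (g j) ⊆ U) :
    ∃ h : (ℕ → ℕ) → X, Continuous h ∧ Function.Injective h ∧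
      range h = {d} ∪ ⋃ j, range (g j) ∧
      ∀ j, ∃ V : Set (ℕ → ℕ), IsOpen V ∧ V.Nonempty ∧ h '' V ⊆ range (g j) := by
  classical
  let sh : ℕ → (ℕ → ℕ) → (ℕ → ℕ) := fun j x n => if n = 0 then x j - 1 else x (j + n)
  let em : ℕ → (ℕ → ℕ) → (ℕ → ℕ) := fun j y n =>
    if n < j then 0 else if n = j then y 0 + 1 else y (n - j)
  let N : ℕ → Set (ℕ → ℕ) := fun j => {x | (∀ i < j, x i = 0) ∧ x j ≠ 0}
  let h : (ℕ → ℕ) → X := fun x =>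
    if hx : ∃ j, x j ≠ 0 then g (Nat.find hx) (sh (Nat.find hx) x) else d
  have hshc : ∀ j, Continuous (sh j) := by
    intro j
    refine continuous_pi (fun n => ?_)
    by_cases hn : n = 0
    · simp only [sh, hn, if_true]
      exact (continuous_of_discreteTopology (f := fun k : ℕ => k - 1)).comp (continuous_apply j)
    · simp only [sh, hn, if_false]
      exact continuous_apply _
  have hZ : ∀ J, IsOpen {x : ℕ → ℕ | ∀ i < J, x i = 0} := by
    intro J
    have : {x : ℕ → ℕ | ∀ i < J, x i = 0} = ⋂ i ∈ Set.Iio J, (fun x : ℕ → ℕ => x i) ⁻¹' {0} := by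
      ext x; simp
    rw [this]
    exact (Set.finite_Iio J).isOpen_biInter
      (fun i _ => (isOpen_discrete _).preimage (continuous_apply i))
  have hN : ∀ j, IsOpen (N j) := by
    intro j
    have h1 : IsOpen ((fun x : ℕ → ℕ => x j) ⁻¹' ({0}ᶜ : Set ℕ)) :=
      (isOpen_discrete _).preimage (continuous_apply j)
    have h2 : N j = {x : ℕ → ℕ | ∀ i < j, x i = 0} ∩ (fun x : ℕ → ℕ => x j) ⁻¹' ({0}ᶜ : Set ℕ) := by
      ext x; simp [N]
    rw [h2]
    exact (hZ j).inter h1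
  have hNh : ∀ j, ∀ x ∈ N j, h x = g j (sh j x) := by
    intro j x hx
    have hex : ∃ j, x j ≠ 0 := ⟨j, hx.2⟩
    have : Nat.find hex = j := by
      rw [Nat.find_eq_iff]
      exact ⟨hx.2, fun n hn => not_not.2 (hx.1 n hn)⟩
    simp only [h, dif_pos hex, this]
  have hcase : ∀ x : ℕ → ℕ, (∃ j, x ∈ N j) ∨ x = 0 := by
    intro x
    by_cases hex : ∃ j, x j ≠ 0
    · exact Or.inl ⟨Nat.find hex, fun i hi => not_not.1 (Nat.find_min hex hi), Nat.find_spec hex⟩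
    · push Not at hex
      exact Or.inr (funext hex)
  have h0 : h 0 = d := by simp [h]
  have hem : ∀ j y, em j y ∈ N j := by
    intro j y
    refine ⟨fun i hi => by simp [em, hi], by simp [em]⟩
  have hshem : ∀ j y, sh j (em j y) = y := by
    intro j y
    funext n
    by_cases hn : n = 0
    · simp [sh, em, hn]
    · simp [sh, em, hn]
  have hshinj : ∀ j, ∀ x ∈ N j, ∀ y ∈ N j, sh j x = sh j y → x = y := by
    intro j x hx y hy hxy
    funext n
    rcases lt_trichotomy n j with hn | hn | hn
    · rw [hx.1 n hn, hy.1 n hn]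
    · subst hn
      have := congrFun hxy 0
      simp only [sh, if_true] at this
      have h1 := hx.2
      have h2 := hy.2
      omega
    · have := congrFun hxy (n - j)
      have hne : n - j ≠ 0 := by omega
      simp only [sh, hne, if_false] at this
      rwa [show j + (n - j) = n by omega] at this
  refine ⟨h, ?_, ?_, ?_, ?_⟩
  · rw [continuous_iff_continuousAt]
    intro x
    rcases hcase x with ⟨j, hj⟩ | rfl
    · have : h =ᶠ[nhds x] fun y => g j (sh j y) :=
        Filter.eventually_of_mem ((hN j).mem_nhds hj) (hNh j)
      exact (((hc j).comp (hshc j)).continuousAt).congr this.symm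
    · intro U hU
      rw [h0] at hU
      obtain ⟨J, hJ⟩ := hlim U hU
      have h0J : (0 : ℕ → ℕ) ∈ {x : ℕ → ℕ | ∀ i < J, x i = 0} := by simp
      rw [Filter.mem_map]
      refine Filter.mem_of_superset ((hZ J).mem_nhds h0J) ?_
      intro y hy
      rcases hcase y with ⟨j, hj⟩ | rfl
      · have hjJ : J ≤ j := by
          by_contra hlt
          exact hj.2 (hy j (not_le.1 hlt))
        rw [mem_preimage, hNh j y hj]
        exact hJ j hjJ (mem_range_self _)
      · rw [mem_preimage, h0]
        exact mem_of_mem_nhds hU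
  · intro x y hxy
    rcases hcase x with ⟨i, hx⟩ | rfl <;> rcases hcase y with ⟨j, hy⟩ | rfl
    · rw [hNh i x hx, hNh j y hy] at hxy
      by_cases hij : i = j
      · subst hij
        exact hshinj i x hx y hy (hi i hxy)
      · exact absurd (hxy ▸ mem_range_self (f := g j) (sh j y))
          (Set.disjoint_left.1 (hd i j hij) (mem_range_self _))
    · rw [hNh i x hx, h0] at hxy
      exact absurd ⟨_, hxy⟩ (hdg i)
    · rw [hNh j y hy, h0] at hxy
      exact absurd ⟨_, hxy.symm⟩ (hdg j)
    · rfl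
  · ext z
    constructor
    · rintro ⟨x, rfl⟩
      rcases hcase x with ⟨i, hx⟩ | rfl
      · rw [hNh i x hx]
        exact Or.inr (mem_iUnion.2 ⟨i, mem_range_self _⟩)
      · exact Or.inl h0
    · rintro (hz | hz)
      · exact ⟨0, h0.trans hz.symm⟩
      · obtain ⟨j, y, rfl⟩ := mem_iUnion.1 hz
        exact ⟨em j y, by rw [hNh j _ (hem j y), hshem]⟩
  · intro j
    refine ⟨N j, hN j, ⟨em j 0, hem j 0⟩, ?_⟩
    rintro _ ⟨x, hx, rfl⟩
    rw [hNh j x hx]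
    exact mem_range_self _

lemma glue {X ι : Type*} [TopologicalSpace X] [Countable ι] [Nonempty ι] (h : ι → (ℕ → ℕ) → X)
    (hc : ∀ i, Continuous (h i)) (hi : ∀ i, Function.Injective (h i))
    (hd : ∀ i j, i ≠ j → Disjoint (range (h i)) (range (h j)))
    (hcov : ∀ x, ∃ i, x ∈ range (h i)) :
    ∃ f : (ℕ → ℕ) → X, Continuous f ∧ Function.Bijective f ∧
      ∀ i, ∀ V : Set (ℕ → ℕ), IsOpen V → V.Nonempty →
        ∃ W : Set (ℕ → ℕ), IsOpen W ∧ W.Nonempty ∧ f '' W ⊆ h i '' V := by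
  obtain ⟨hden⟩ := nonempty_denumerable (ι × ℕ)
  let e : ι × ℕ ≃ ℕ := Denumerable.eqv (ι × ℕ)
  let u : (ℕ → ℕ) → (ℕ → ℕ) := fun x => Function.update x 0 (e.symm (x 0)).2
  have hu : Continuous u := by
    refine continuous_id.update 0 ?_
    exact (continuous_of_discreteTopology (f := fun k : ℕ => (e.symm k).2)).comp (continuous_apply 0)
  let p : (ℕ → ℕ) → ι := fun x => (e.symm (x 0)).1
  have hp : ∀ i, IsOpen {x | p x = i} := by
    intro i
    have h1 : IsOpen ((fun x : ℕ → ℕ => x 0) ⁻¹' {k : ℕ | (e.symm k).1 = i}) :=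
      (isOpen_discrete _).preimage (continuous_apply 0)
    exact h1
  let v : ι → (ℕ → ℕ) → (ℕ → ℕ) := fun i y => Function.update y 0 (e (i, y 0))
  have hpv : ∀ i y, p (v i y) = i := by intro i y; simp [p, v]
  have huv : ∀ i y, u (v i y) = y := by intro i y; simp [u, v]
  have hvu : ∀ x, v (p x) (u x) = x := by
    intro x
    simp [u, v, p]
  refine ⟨fun x => h (p x) (u x), ?_, ⟨?_, ?_⟩, ?_⟩
  · rw [continuous_iff_continuousAt]
    intro x
    have : (fun y => h (p y) (u y)) =ᶠ[nhds x] fun y => h (p x) (u y) :=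
      Filter.eventually_of_mem ((hp (p x)).mem_nhds rfl) (fun y hy => by
        have hy' : p y = p x := hy
        simp only [hy'])
    exact (((hc _).comp hu).continuousAt).congr this.symm
  · intro x y hxy
    have hxy' : h (p x) (u x) = h (p y) (u y) := hxy
    have hpp : p x = p y := by
      by_contra hne
      exact Set.disjoint_left.1 (hd _ _ hne) (mem_range_self (u x)) (hxy' ▸ mem_range_self (u y))
    rw [hpp] at hxy'
    rw [← hvu x, ← hvu y, hi _ hxy', hpp]
  · intro z
    obtain ⟨i, y, rfl⟩ := hcov z
    exact ⟨v i y, by simp only [hpv, huv]⟩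
  · intro i V hV ⟨y, hy⟩
    refine ⟨{x | p x = i} ∩ u ⁻¹' V, (hp i).inter (hV.preimage hu),
      ⟨v i y, hpv i y, by rw [mem_preimage, huv]; exact hy⟩, ?_⟩
    rintro _ ⟨x, ⟨hx, hx2⟩, rfl⟩
    have hx' : p x = i := hx
    exact ⟨u x, hx2, by simp only [hx']⟩

lemma exists_bij {X : Type*} [TopologicalSpace X] [PolishSpace X] [MeasurableSpace X]
    [BorelSpace X] [Nonempty X] (Q : ℕ → Set X) (hQ : ∀ n, MeasurableSet (Q n))
    (hQu : ∀ n, ¬ (Q n).Countable) (hQn : ∀ x : X, ∀ U ∈ nhds x, ∃ m, Q m ⊆ U) :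
    ∃ f : (ℕ → ℕ) → X, Continuous f ∧ Function.Bijective f ∧
      ∀ m, ∃ W : Set (ℕ → ℕ), IsOpen W ∧ W.Nonempty ∧ f '' W ⊆ Q m := by
  obtain ⟨B, hBQ, hBm, hBu, hBd, hBU⟩ := partition_refine (fun n => Q n.unpair.1)
    (fun n => hQ _) (fun n => hQu _)
  choose g hgc hgi hgB hgco using fun n => borel_param (hBm n) (hBu n)
  have hgd : ∀ i j, i ≠ j → Disjoint (range (g i)) (range (g j)) := fun i j hij =>
    (hBd hij).mono (hgB i) (hgB j)
  let D : Set X := (⋃ n, range (g n))ᶜ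
  have hD : D.Countable := by
    refine (countable_iUnion hgco).mono ?_
    intro x hx
    have : x ∈ ⋃ n, B n := hBU ▸ mem_univ x
    obtain ⟨n, hn⟩ := mem_iUnion.1 this
    exact mem_iUnion.2 ⟨n, hn, fun h => hx (mem_iUnion.2 ⟨n, h⟩)⟩
  have : Countable D := hD.to_subtype
  obtain ⟨enc, henc⟩ := exists_injective_nat (D × ℕ)
  have hbas : ∀ d : D, ∃ U : ℕ → Set X, (nhds (d : X)).HasAntitoneBasis U := fun d =>
    (nhds (d : X)).exists_antitone_basis
  choose U hU using hbas
  choose m hm using fun (d : D) (j : ℕ) => hQn d (U d j) ((hU d).1.mem_of_mem trivial)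
  let φ : D → ℕ → ℕ := fun d j => Nat.pair (m d j) (enc (d, j)) + 1
  have hφ : ∀ d j d' j', φ d j = φ d' j' → d = d' ∧ j = j' := by
    intro d j d' j' h
    have h1 : Nat.pair (m d j) (enc (d, j)) = Nat.pair (m d' j') (enc (d', j')) := Nat.succ.inj h
    rw [Nat.pair_eq_pair] at h1
    have := henc h1.2
    simpa using this
  have hφU : ∀ d j, range (g (φ d j)) ⊆ U d j := by
    intro d j
    refine (hgB _).trans ((hBQ _).trans ?_)
    simp only [Nat.unpair_pair]
    exact hm d j
  have habs := fun d : D => absorb (d : X) (fun j => g (φ d j)) (fun j => hgc _) (fun j => hgi _)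
    (fun i j hij => hgd _ _ (fun h => hij (hφ _ _ _ _ h).2))
    (fun j h => d.2 (mem_iUnion.2 ⟨_, h⟩))
    (fun V hV => by
      obtain ⟨J, -, hJ⟩ := (hU d).1.mem_iff.1 hV
      exact ⟨J, fun j hj => (hφU d j).trans (((hU d).2 hj).trans hJ)⟩)
  choose h hhc hhi hhr hhV using habs
  let Un : Set ℕ := {n | ∀ d j, φ d j ≠ n}
  let H : D ⊕ Un → (ℕ → ℕ) → X := Sum.elim h (fun n => g n)
  have hcov : ∀ x, ∃ i, x ∈ range (H i) := by
    intro x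
    by_cases hx : x ∈ D
    · refine ⟨Sum.inl ⟨x, hx⟩, ?_⟩
      change x ∈ range (h ⟨x, hx⟩)
      rw [hhr]
      exact Or.inl rfl
    · obtain ⟨n, hn⟩ := mem_iUnion.1 (not_not.1 hx)
      by_cases hUn : n ∈ Un
      · exact ⟨Sum.inr ⟨n, hUn⟩, hn⟩
      · simp only [Un, mem_ofPred_eq, not_forall, not_not] at hUn
        obtain ⟨d, j, rfl⟩ := hUn
        refine ⟨Sum.inl d, ?_⟩
        change x ∈ range (h d)
        rw [hhr]
        exact Or.inr (mem_iUnion.2 ⟨j, hn⟩)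
  have : Nonempty (D ⊕ Un) := by
    obtain ⟨x⟩ := ‹Nonempty X›
    exact ⟨(hcov x).choose⟩
  have hlr : ∀ (d : D) (n : Un), Disjoint (range (h d)) (range (g n)) := by
    intro d n
    rw [hhr, Set.disjoint_left]
    rintro x (hx | hx) hxn
    · have hx' : x = d := hx
      exact d.2 (mem_iUnion.2 ⟨_, hx' ▸ hxn⟩)
    · obtain ⟨j, hj⟩ := mem_iUnion.1 hx
      exact Set.disjoint_left.1 (hgd _ _ (n.2 d j)) hj hxn
  obtain ⟨f, hf1, hf2, hf3⟩ := glue H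
    (by rintro (d | n); exacts [hhc d, hgc n])
    (by rintro (d | n); exacts [hhi d, hgi n])
    (by
      rintro (d | n) (d' | n') hne
      · change Disjoint (range (h d)) (range (h d'))
        have hdd : d ≠ d' := fun h => hne (h ▸ rfl)
        rw [hhr, hhr, Set.disjoint_left]
        rintro x (hx | hx) (hx' | hx')
        · exact hdd (Subtype.ext ((show x = d from hx).symm.trans hx'))
        · obtain ⟨j, hj⟩ := mem_iUnion.1 hx'
          exact d.2 (mem_iUnion.2 ⟨_, (show x = d from hx) ▸ hj⟩)
        · obtain ⟨j, hj⟩ := mem_iUnion.1 hx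
          exact d'.2 (mem_iUnion.2 ⟨_, (show x = d' from hx') ▸ hj⟩)
        · obtain ⟨j, hj⟩ := mem_iUnion.1 hx
          obtain ⟨j', hj'⟩ := mem_iUnion.1 hx'
          exact Set.disjoint_left.1 (hgd _ _ (fun h => hdd (hφ _ _ _ _ h).1)) hj hj'
      · exact hlr d n'
      · exact (hlr d' n).symm
      · exact hgd _ _ (fun h => hne (congrArg Sum.inr (Subtype.ext h))))
    hcov
  refine ⟨f, hf1, hf2, fun k => ?_⟩
  have hkQ : range (g (Nat.pair k 0 + 1)) ⊆ Q k := by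
    refine (hgB _).trans ((hBQ _).trans ?_)
    simp only [Nat.unpair_pair]
    exact Subset.rfl
  by_cases hUn : Nat.pair k 0 + 1 ∈ Un
  · obtain ⟨W, hW1, hW2, hW3⟩ := hf3 (Sum.inr ⟨_, hUn⟩) univ isOpen_univ univ_nonempty
    refine ⟨W, hW1, hW2, hW3.trans ?_⟩
    rw [image_univ]
    exact hkQ
  · simp only [Un, mem_ofPred_eq, not_forall, not_not] at hUn
    obtain ⟨d, j, hdj⟩ := hUn
    obtain ⟨V, hV1, hV2, hV3⟩ := hhV d j
    obtain ⟨W, hW1, hW2, hW3⟩ := hf3 (Sum.inl d) V hV1 hV2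
    refine ⟨W, hW1, hW2, hW3.trans (hV3.trans ?_)⟩
    rw [hdj]
    exact hkQ

lemma perfect_unc {X : Type*} [TopologicalSpace X] [PolishSpace X] {P U : Set X}
    (hP : Perfect P) (hU : IsOpen U) (hne : (U ∩ P).Nonempty) : ¬ (U ∩ P).Countable := by
  let := TopologicalSpace.upgradeIsCompletelyMetrizable X
  obtain ⟨x, hxU, hxP⟩ := hne
  obtain ⟨ε, hε, hεU⟩ := Metric.isOpen_iff.1 hU x hxU
  obtain ⟨hC, hCn⟩ := hP.closure_nhds_inter x hxP (Metric.mem_ball_self (half_pos hε))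
    Metric.isOpen_ball
  obtain ⟨f, hfr, hfc, hfi⟩ := hC.exists_nat_bool_injection hCn
  intro hcount
  have hsub : closure (Metric.ball x (ε / 2) ∩ P) ⊆ U ∩ P := by
    refine subset_inter ?_ ?_
    · refine (closure_mono inter_subset_left).trans ?_
      exact (Metric.closure_ball_subset_closedBall.trans
        (Metric.closedBall_subset_ball (half_lt_self hε))).trans hεU
    · exact closure_minimal inter_subset_right hP.closed
  have h1 : (range f).Countable := hcount.mono (hfr.trans hsub)
  have h2 : Countable (ℕ → Bool) := by
    have := h1.to_subtype
    exact (Equiv.ofInjective f hfi).injective.countable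
  obtain ⟨c, hc⟩ := exists_injective_nat (ℕ → Bool)
  exact Function.cantor_injective (fun s : Set ℕ => c (fun n => @decide (n ∈ s) (Classical.dec _)))
    (fun s t hst => by
      ext n
      have := congrFun (hc hst) n
      simpa using this)

lemma perfect_closure_image {X : Type*} [TopologicalSpace X] {f : (ℕ → ℕ) → X}
    (hf : Continuous f) (hi : Function.Injective f) {V : Set (ℕ → ℕ)} (hV : IsOpen V)
    (hne : V.Nonempty) : PerfectSet (closure (f '' V)) := by
  refine ⟨Preperfect.perfect_closure ?_, (hne.image f).closure⟩
  rw [preperfect_iff_nhds]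
  rintro _ ⟨x, hx, rfl⟩ U hU
  have hW : f ⁻¹' U ∩ V ∈ nhds x := Filter.inter_mem (hf.continuousAt hU) (hV.mem_nhds hx)
  have : ∃ y ∈ f ⁻¹' U ∩ V, y ≠ x := by
    have ht : Filter.Tendsto (fun n : ℕ => Function.update x n (x n + 1)) Filter.atTop (nhds x) := by
      rw [tendsto_pi_nhds]
      intro i
      refine tendsto_const_nhds.congr' ?_
      filter_upwards [Filter.eventually_gt_atTop i] with n hn
      rw [Function.update_of_ne hn.ne]
    obtain ⟨n, hn⟩ := (ht.eventually hW).exists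
    refine ⟨_, hn, fun h => ?_⟩
    have := congrFun h n
    simp at this
  obtain ⟨y, ⟨hyU, hyV⟩, hyx⟩ := this
  exact ⟨f y, ⟨hyU, y, hyV, rfl⟩, fun h => hyx (hi h)⟩

lemma forward {X : Type*} [TopologicalSpace X] [PolishSpace X] (A : Set X) (hA : CPM A)
    (f : (ℕ → ℕ) → X) (hf : Continuous f) (hi : Function.Injective f) :
    ∃ F : ℕ → Set X, (∀ n, IsClosed (F n)) ∧ A ⊆ ⋃ n, F n ∧
      ∀ n, IsNowhereDense (f ⁻¹' F n) := by
  obtain ⟨b, hbc, hbe, hb⟩ := TopologicalSpace.exists_countable_basis (ℕ → ℕ)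
  have hbne : b.Nonempty := by
    obtain ⟨V, hV, -⟩ := hb.exists_subset_of_mem_open (mem_univ (0 : ℕ → ℕ)) isOpen_univ
    exact ⟨V, hV⟩
  obtain ⟨V, rfl⟩ := hbc.exists_eq_range hbne
  have hVo : ∀ n, IsOpen (V n) := fun n => hb.isOpen (mem_range_self n)
  have hVn : ∀ n, (V n).Nonempty := fun n =>
    nonempty_iff_ne_empty.2 (fun h => hbe ⟨n, h⟩)
  obtain ⟨_, ⟨F, hFc, rfl⟩, hAF, hFm⟩ := hA (fun n => closure (f '' V n))
    (fun n => perfect_closure_image hf hi (hVo n) (hVn n))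
  refine ⟨F, hFc, hAF, fun n => ?_⟩
  rw [IsNowhereDense, ((hFc n).preimage hf).closure_eq]
  by_contra hne
  obtain ⟨x, hx⟩ := nonempty_iff_ne_empty.2 hne
  obtain ⟨_, ⟨k, rfl⟩, hxk, hk⟩ := hb.exists_subset_of_mem_open hx isOpen_interior
  have hsub : closure (f '' V k) ⊆ F n :=
    closure_minimal (image_subset_iff.2 (hk.trans interior_subset)) (hFc n)
  have hm := hFm k
  have : PolishSpace (closure (f '' V k)) := isClosed_closure.polishSpace
  have : Nonempty (closure (f '' V k)) := ((hVn k).image f).closure.to_subtype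
  have huniv : ((↑) ⁻¹' (⋃ n, F n) : Set (closure (f '' V k))) = univ := by
    rw [eq_univ_iff_forall]
    intro y
    exact mem_iUnion.2 ⟨n, hsub y.2⟩
  unfold MeagerIn at hm
  rw [huniv] at hm
  exact not_isMeagre_of_isOpen isOpen_univ univ_nonempty hm

lemma backward {X : Type*} [TopologicalSpace X] [PolishSpace X]
    (hX : Perfect (Set.univ : Set X)) (A : Set X)
    (hA : ∀ f : (ℕ → ℕ) → X, Continuous f → Function.Bijective f →
        ∃ F : ℕ → Set X, (∀ n, IsClosed (F n)) ∧ A ⊆ ⋃ n, F n ∧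
          ∀ n, IsNowhereDense (f ⁻¹' F n)) : CPM A := by
  intro P hP
  have hne : Nonempty X := ⟨(hP 0).2.some⟩
  borelize X
  obtain ⟨b, hbc, hbe, hb⟩ := TopologicalSpace.exists_countable_basis X
  let P' : ℕ → Set X := fun n => Nat.casesOn n univ P
  have hP' : ∀ n, PerfectSet (P' n) := by
    rintro (_ | n)
    · exact ⟨hX, univ_nonempty⟩
    · exact hP n
  let 𝒬 : Set (Set X) := {S | S.Nonempty ∧ ∃ U ∈ b, ∃ n, S = U ∩ P' n}
  have h𝒬c : 𝒬.Countable := by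
    refine (hbc.biUnion (t := fun U _ => range (fun n => U ∩ P' n))
      (fun U _ => countable_range _)).mono ?_
    rintro S ⟨-, U, hU, n, rfl⟩
    exact mem_biUnion hU ⟨n, rfl⟩
  have hmem : ∀ x : X, ∀ U, IsOpen U → x ∈ U → ∀ n, x ∈ P' n → ∃ S ∈ 𝒬, S ⊆ U ∩ P' n := by
    intro x U hU hxU n hxn
    obtain ⟨W, hW, hxW, hWU⟩ := hb.exists_subset_of_mem_open hxU hU
    exact ⟨W ∩ P' n, ⟨⟨x, hxW, hxn⟩, W, hW, n, rfl⟩, inter_subset_inter_left _ hWU⟩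
  obtain ⟨Q, hQ⟩ := h𝒬c.exists_eq_range (by
    obtain ⟨S, hS, -⟩ := hmem hne.some univ isOpen_univ (mem_univ _) 0 (mem_univ _)
    exact ⟨S, hS⟩)
  have hQmem : ∀ n, Q n ∈ 𝒬 := fun n => hQ ▸ mem_range_self n
  obtain ⟨f, hfc, hfb, hfW⟩ := exists_bij Q
    (fun n => by
      obtain ⟨-, U, hU, k, h⟩ := hQmem n
      rw [h]
      exact (hb.isOpen hU).measurableSet.inter (hP' k).1.closed.measurableSet)
    (fun n => by
      obtain ⟨h0, U, hU, k, h⟩ := hQmem n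
      rw [h] at h0 ⊢
      exact perfect_unc (hP' k).1 (hb.isOpen hU) h0)
    (fun x U hU => by
      obtain ⟨W, hWU, hW, hxW⟩ := mem_nhds_iff.1 hU
      obtain ⟨S, hS, hSW⟩ := hmem x W hW hxW 0 (mem_univ _)
      rw [hQ] at hS
      obtain ⟨m, rfl⟩ := hS
      exact ⟨m, hSW.trans (inter_subset_left.trans hWU)⟩)
  obtain ⟨F, hFc, hAF, hFn⟩ := hA f hfc hfb
  refine ⟨⋃ n, F n, ⟨F, hFc, rfl⟩, hAF, fun n => ?_⟩
  unfold MeagerIn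
  rw [preimage_iUnion]
  refine isMeagre_iUnion (fun k => IsNowhereDense.isMeagre ?_)
  rw [IsNowhereDense, ((hFc k).preimage continuous_subtype_val).closure_eq]
  by_contra hcon
  obtain ⟨x, hx⟩ := nonempty_iff_ne_empty.2 hcon
  obtain ⟨U, hU, hUeq⟩ := isOpen_induced_iff.1
    (isOpen_interior (s := ((↑) ⁻¹' F k : Set (P n))))
  have hxU : (x : X) ∈ U := by
    rw [← hUeq] at hx
    exact hx
  obtain ⟨S, hS, hSU⟩ := hmem x U hU hxU (n + 1) x.2
  rw [hQ] at hS
  obtain ⟨m, rfl⟩ := hS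
  obtain ⟨W, hW, ⟨w, hw⟩, hWQ⟩ := hfW m
  have hWF : W ⊆ f ⁻¹' F k := by
    intro y hy
    obtain ⟨hyU, hyP⟩ := hSU (hWQ ⟨y, hy, rfl⟩)
    have : (⟨f y, hyP⟩ : P n) ∈ interior ((↑) ⁻¹' F k : Set (P n)) := by
      rw [← hUeq]
      exact hyU
    have h2 : (⟨f y, hyP⟩ : P n) ∈ ((↑) ⁻¹' F k : Set (P n)) := interior_subset this
    exact h2
  have hnd := hFn k
  rw [IsNowhereDense, ((hFc k).preimage hfc).closure_eq] at hnd
  have : w ∈ interior (f ⁻¹' F k) := interior_maximal hWF hW hw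
  rw [hnd] at this
  exact this

theorem stmt7 {X : Type*} [TopologicalSpace X] [PolishSpace X]
    (hX : Perfect (Set.univ : Set X)) (A : Set X) :
    CPM A ↔
      ∀ f : (ℕ → ℕ) → X, Continuous f → Function.Bijective f →
        ∃ F : ℕ → Set X, (∀ n, IsClosed (F n)) ∧ A ⊆ ⋃ n, F n ∧
          ∀ n, IsNowhereDense (f ⁻¹' F n) := by
  exact ⟨fun hA f hf hb => forward A hA f hf hb.1, fun hA => backward hX A hA⟩
end

section
/- Assuming the Continuum Hypothesis, there exists a universally meager subset of 2^ℕ which is not countably perfectly meager in 2^ℕ. -/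
open Set

/-- `A ⊆ 2^ℕ` is universally meager: every Borel isomorphism onto a perfect
Polish space sends `A` to a meager set. -/
def UniversallyMeager (A : Set (ℕ → Bool)) : Prop :=
  ∀ (Y : Type) [TopologicalSpace Y] [PolishSpace Y] [MeasurableSpace Y] [BorelSpace Y],
    Perfect (Set.univ : Set Y) →
    ∀ f : (ℕ → Bool) → Y, Function.Bijective f → Measurable f →
      Measurable (Function.invFun f) → IsMeagre (f '' A)

open Filter Topology

/-- A countable enumerated family of open sets generating all open sets by unions. -/
lemma exists_open_enum (Z : Type*) [TopologicalSpace Z] [SecondCountableTopology Z] :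
    ∃ U : ℕ → Set Z, (∀ n, IsOpen (U n)) ∧
      (∀ O : Set Z, IsOpen O → ∀ x ∈ O, ∃ n, x ∈ U n ∧ U n ⊆ O) := by
  obtain ⟨U, hU⟩ := ((TopologicalSpace.countable_countableBasis Z).insert ∅).exists_eq_range
    (insert_nonempty _ _)
  refine ⟨U, fun n => ?_, fun O hO x hx => ?_⟩
  · have : U n ∈ insert ∅ (TopologicalSpace.countableBasis Z) := hU ▸ mem_range_self n
    rcases this with h | h
    · rw [h]; exact isOpen_empty
    · exact TopologicalSpace.isOpen_of_mem_countableBasis h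
  · obtain ⟨V, hV, hxV, hVO⟩ :=
      (TopologicalSpace.isBasis_countableBasis Z).exists_subset_of_mem_open hx hO
    have : V ∈ range U := hU ▸ mem_insert_of_mem _ hV
    obtain ⟨n, rfl⟩ := this
    exact ⟨n, hxV, hVO⟩

/-- Key criterion for universal meagerness. -/
lemma um_of_rel (A : Set (ℕ → Bool)) (R : ℕ → (ℕ → Bool) → (ℕ → Bool) → Prop)
    (hcl : ∀ k x, IsClosed {y | R k x y})
    (h1 : ∀ x ∈ A, {y ∈ A | ∀ k, ¬ R k x y}.Countable)
    (h2 : ∀ y ∈ A, {x ∈ A | ∃ k, R k x y}.Countable) : UniversallyMeager A := by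
  intro Y _ _ _ _ hY f hf hfm hfi
  have hctb : ∀ s : Set Y, s.Countable → IsMeagre s := by
    intro s hs
    rw [← biUnion_of_singleton s]
    refine isMeagre_biUnion hs fun y _ => ?_
    have : NeBot (𝓝[≠] y) := by
      have := hY.acc y (mem_univ y)
      simpa [AccPt] using this
    apply IsNowhereDense.isMeagre
    rw [isClosed_singleton.isNowhereDense_iff, interior_singleton]
  obtain ⟨U, hUo, hU⟩ := exists_open_enum (ℕ → Bool)
  obtain ⟨V, hVo, hV⟩ := exists_open_enum Y
  have hinv : ∀ x, Function.invFun f (f x) = x := Function.leftInverse_invFun hf.1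
  have hO : ∀ n, ∃ O : Set Y, IsOpen O ∧ (Function.invFun f ⁻¹' U n) =ᶠ[residual Y] O :=
    fun n => (hfi (hUo n).measurableSet).residualEq_isOpen
  choose O hOo hO using hO
  have hG : ∀ᶠ y in residual Y, ∀ n, (Function.invFun f y ∈ U n ↔ y ∈ O n) := by
    rw [eventually_countable_forall]
    intro n
    exact (hO n).mem_iff
  set G : Set Y := {y | ∀ n, (Function.invFun f y ∈ U n ↔ y ∈ O n)} with hGdef
  have hGm : IsMeagre Gᶜ := by
    rw [IsMeagre, compl_compl]; exact hG
  by_contra hT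
  have hT' : ¬ IsMeagre (f '' A ∩ G) := by
    intro h
    apply hT
    refine (h.union hGm).mono fun y hy => ?_
    by_cases hyG : y ∈ G
    · exact Or.inl ⟨hy, hyG⟩
    · exact Or.inr hyG
  apply hT'
  set T := f '' A ∩ G
  let S : ℕ × ℕ → Set (ℕ → Bool) := fun kn =>
    {x ∈ A | (∃ y ∈ A, f y ∈ V kn.2 ∩ G) ∧ ∀ y ∈ A, f y ∈ V kn.2 ∩ G → R kn.1 x y}
  have hS : ∀ kn, (S kn).Countable := by
    intro kn
    by_cases hne : ∃ y ∈ A, f y ∈ V kn.2 ∩ G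
    · obtain ⟨y, hyA, hy⟩ := hne
      exact (h2 y hyA).mono (fun x (hx : x ∈ S kn) =>
        show x ∈ {x ∈ A | ∃ k, R k x y} from ⟨hx.1, kn.1, hx.2.2 y hyA hy⟩)
    · convert countable_empty
      ext x
      simp only [mem_empty_iff_false, iff_false]
      exact fun hx => hne hx.2.1
  refine (hctb _ ((countable_iUnion hS).image f)).mono ?_
  rintro _ ⟨⟨x, hx, rfl⟩, hxG⟩
  refine ⟨x, ?_, rfl⟩
  have hk : ∃ k, ¬ IsMeagre (f '' {y ∈ A | R k x y} ∩ G) := by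
    by_contra hcon
    push Not at hcon
    apply hT'
    refine ((isMeagre_iUnion hcon).union (hctb _ ((h1 x hx).image f))).mono ?_
    rintro _ ⟨⟨y, hy, rfl⟩, hyG⟩
    by_cases h : ∃ k, R k x y
    · obtain ⟨k, hk⟩ := h
      exact Or.inl (mem_iUnion.2 ⟨k, ⟨y, ⟨hy, hk⟩, rfl⟩, hyG⟩)
    · push Not at h
      exact Or.inr ⟨y, ⟨hy, h⟩, rfl⟩
  obtain ⟨k, hk⟩ := hk
  have hint : (interior (closure (f '' {y ∈ A | R k x y} ∩ G))).Nonempty := by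
    rw [nonempty_iff_ne_empty]
    intro h
    exact hk (IsNowhereDense.isMeagre h)
  obtain ⟨y0, hy0⟩ := hint
  obtain ⟨n, hyn, hn⟩ := hV _ isOpen_interior y0 hy0
  refine mem_iUnion.2 ⟨(k, n), hx, ?_, ?_⟩
  · obtain ⟨w, hw1, ⟨y, hy, rfl⟩, hw3⟩ := mem_closure_iff.1 (interior_subset hy0) _ (hVo n) hyn
    exact ⟨y, hy.1, hw1, hw3⟩
  · intro y hy hyV
    by_contra hR
    obtain ⟨m, hm, hmU⟩ := hU {y | R k x y}ᶜ (hcl k x).isOpen_compl y hR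
    have hyO : f y ∈ O m := (hyV.2 m).1 (by rwa [hinv])
    obtain ⟨w, hw1, ⟨z, hz, rfl⟩, hw3⟩ :=
      mem_closure_iff.1 (interior_subset (hn hyV.1)) _ (hOo m) hyO
    have := (hw3 m).2 hw1
    rw [hinv] at this
    exact hmU this hz.2

/-- counting function -/
def cnt (q : ℕ → Bool) (m : ℕ) : ℕ := ∑ i ∈ Finset.range m, (q i).toNat

def Unb (q : ℕ → Bool) : Prop := ∀ N, ∃ m, N ≤ cnt q m

def RR (k : ℕ) (p q : ℕ → Bool) : Prop := ∀ m, k ≤ m → cnt q m < cnt p m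

def dd (s : Finset ℕ) : ℕ → Bool := fun n => decide (n ∈ s)

lemma continuous_cnt (m : ℕ) : Continuous fun q => cnt q m := by
  unfold cnt
  refine continuous_finsetSum _ fun i _ => ?_
  exact (continuous_of_discreteTopology (f := Bool.toNat)).comp
    (continuous_apply (A := fun _ => Bool) i)

lemma cnt_mono (q : ℕ → Bool) {m n : ℕ} (h : m ≤ n) : cnt q m ≤ cnt q n :=
  Finset.sum_le_sum_of_subset (Finset.range_mono h)

lemma cnt_eq (q : ℕ → Bool) (m : ℕ) : cnt q m = ((Finset.range m).filter (fun i => q i = true)).card := by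
  rw [Finset.card_filter]
  refine Finset.sum_congr rfl fun i _ => ?_
  cases q i <;> simp

lemma nbhd_fin (O : Set (ℕ → Bool)) (hO : IsOpen O) (p : ℕ → Bool) (hp : p ∈ O) :
    ∃ M, ∀ q : ℕ → Bool, (∀ n < M, q n = p n) → q ∈ O := by
  obtain ⟨I, u, hu, hI⟩ := isOpen_pi_iff.1 hO p hp
  refine ⟨I.sup id + 1, fun q hq => hI ?_⟩
  intro i hi
  rw [hq i (Nat.lt_succ_of_le (Finset.le_sup (f := id) hi))]
  exact (hu i hi).2

lemma exists_pseudo (p : ℕ → ℕ → Bool) (hp : ∀ i, Unb (p i)) (O : ℕ → Set (ℕ → Bool))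
    (hO : ∀ j, IsOpen (O j)) (hd : ∀ j s, dd s ∈ O j) :
    ∃ q, Unb q ∧ (∀ i, ∃ k, RR k (p i) q) ∧ ∀ j, q ∈ O j := by
  have hM : ∀ (j : ℕ) (s : Finset ℕ), ∃ M, (∀ q : ℕ → Bool, (∀ n < M, q n = dd s n) → q ∈ O j) ∧
      (∀ i ≤ j, j + 1 < cnt (p i) M) ∧ ∀ n ∈ s, n < M := by
    intro j s
    obtain ⟨M1, hM1⟩ := nbhd_fin _ (hO j) _ (hd j s)
    choose m hm using fun i => hp i (j + 2)
    refine ⟨max M1 (max ((Finset.range (j + 1)).sup m) (s.sup id + 1)), ?_, ?_, ?_⟩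
    · exact fun q hq => hM1 q fun n hn => hq n (lt_of_lt_of_le hn (le_max_left _ _))
    · intro i hi
      refine lt_of_lt_of_le (hm i) (cnt_mono _ ?_)
      refine le_trans ?_ (le_max_right _ _)
      refine le_trans ?_ (le_max_left _ _)
      exact Finset.le_sup (f := m) (Finset.mem_range.2 (Nat.lt_succ_of_le hi))
    · intro n hn
      have := Finset.le_sup (f := id) hn
      simp only [id] at this
      have h2 : s.sup id + 1 ≤ max M1 (max ((Finset.range (j + 1)).sup m) (s.sup id + 1)) :=
        le_trans (le_max_right _ _) (le_max_right _ _)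
      exact lt_of_lt_of_le (Nat.lt_succ_of_le this) h2
  choose M hM1 hM2 hM3 using hM
  let S : ℕ → Finset ℕ := fun j => Nat.rec ∅ (fun j s => insert (M j s) s) j
  have hS0 : S 0 = ∅ := rfl
  have hSs : ∀ j, S (j + 1) = insert (M j (S j)) (S j) := fun j => rfl
  let N : ℕ → ℕ := fun j => M j (S j)
  have hNs : ∀ j, N j < N (j + 1) := by
    intro j
    apply hM3
    rw [hSs]; exact Finset.mem_insert_self _ _
  have hN : StrictMono N := strictMono_nat_of_lt_succ hNs
  have hmem : ∀ j n, n ∈ S j ↔ ∃ i < j, N i = n := by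
    intro j
    induction j with
    | zero => intro n; simp [hS0]
    | succ j ih =>
      intro n
      rw [hSs, Finset.mem_insert, ih]
      constructor
      · rintro (h | ⟨i, hi, h⟩)
        · exact ⟨j, by omega, h.symm⟩
        · exact ⟨i, by omega, h⟩
      · rintro ⟨i, hi, h⟩
        rcases Nat.lt_succ_iff_lt_or_eq.1 hi with h' | h'
        · exact Or.inr ⟨i, h', h⟩
        · subst h'; exact Or.inl h.symm
  have hcard : ∀ j, (S j).card = j := by
    intro j
    have : S j = (Finset.range j).image N := by
      ext n; simp [hmem]
    rw [this, Finset.card_image_of_injective _ hN.injective, Finset.card_range]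
  classical
  let q : ℕ → Bool := fun n => decide (∃ i, N i = n)
  have hq : ∀ n, q n = true ↔ ∃ i, N i = n := fun n => by simp [q]
  refine ⟨q, ?_, ?_, ?_⟩
  · intro j
    refine ⟨N j, ?_⟩
    rw [cnt_eq]
    conv_lhs => rw [← hcard j]
    apply Finset.card_le_card
    intro n hn
    obtain ⟨i, hi, rfl⟩ := (hmem _ _).1 hn
    rw [Finset.mem_filter, Finset.mem_range, hq]
    exact ⟨hN hi, i, rfl⟩
  · intro i
    refine ⟨N i + 1, fun m hm => ?_⟩
    have hex : ∃ j, m ≤ N j := ⟨m, hN.id_le m⟩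
    have hj := Nat.find_spec hex
    have hjm := fun j => Nat.find_min hex (m := j)
    set j := Nat.find hex
    have hij : i < j := by
      rw [← hN.lt_iff_lt]; omega
    obtain ⟨l, hl⟩ : ∃ l, j = l + 1 := ⟨j - 1, by omega⟩
    have h1 : cnt q m ≤ j := by
      rw [cnt_eq]
      conv_rhs => rw [← hcard j]
      apply Finset.card_le_card
      intro n hn
      rw [Finset.mem_filter, Finset.mem_range, hq] at hn
      obtain ⟨hn, a, rfl⟩ := hn
      exact (hmem _ _).2 ⟨a, hN.lt_iff_lt.1 (by omega), rfl⟩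
    have h2 : l + 1 < cnt (p i) (N l) := hM2 l (S l) i (by omega)
    have h3 : cnt (p i) (N l) ≤ cnt (p i) m := cnt_mono _ (by have := hjm l (by omega); omega)
    omega
  · intro j
    apply hM1 j (S j)
    intro n hn
    have : n < N j := hn
    rw [Bool.eq_iff_iff, hq]
    simp only [dd, decide_eq_true_eq, hmem]
    constructor
    · rintro ⟨i, rfl⟩
      exact ⟨i, hN.lt_iff_lt.1 this, rfl⟩
    · rintro ⟨i, -, h⟩
      exact ⟨i, h⟩

def Good (F : ℕ → Set ((ℕ → Bool) × (ℕ → Bool))) : Prop :=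
  (∀ k, IsClosed (F k)) ∧ ∀ k s (V : Set (ℕ → Bool)), IsOpen V → V.Nonempty →
    ∃ z ∈ V, (dd s, z) ∉ F k

lemma exists_step (F : ℕ → Set ((ℕ → Bool) × (ℕ → Bool))) (hF : Good F)
    (p : ℕ → ℕ → Bool) (hp : ∀ i, Unb (p i)) :
    ∃ x : (ℕ → Bool) × (ℕ → Bool), Unb x.1 ∧ (∀ i, ∃ k, RR k (p i) x.1) ∧ ∀ k, x ∉ F k := by
  obtain ⟨U, hUo, hU⟩ := exists_open_enum (ℕ → Bool)
  let O : ℕ → Set (ℕ → Bool) := fun j =>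
    {q | (U j.unpair.2).Nonempty → ∃ z ∈ U j.unpair.2, (q, z) ∉ F j.unpair.1}
  obtain ⟨q, hq1, hq2, hq3⟩ := exists_pseudo p hp O (by
    intro j
    by_cases h : (U j.unpair.2).Nonempty
    · have : O j = ⋃ z ∈ U j.unpair.2, (fun q => (q, z)) ⁻¹' (F j.unpair.1)ᶜ := by
        ext q; simp [O, h]
      rw [this]
      refine isOpen_biUnion fun z _ => (hF.1 _).isOpen_compl.preimage (by fun_prop)
    · have : O j = univ := by
        ext q; simp [O, h]
      rw [this]; exact isOpen_univ) (fun j s h => hF.2 _ s _ (hUo _) h)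
  have hm : IsMeagre (⋃ k, {z | (q, z) ∈ F k}) := by
    refine isMeagre_iUnion fun k => IsNowhereDense.isMeagre ?_
    have hc : IsClosed {z | (q, z) ∈ F k} := (hF.1 k).preimage (f := fun z => (q, z)) (by fun_prop)
    rw [hc.isNowhereDense_iff, eq_empty_iff_forall_notMem]
    intro z hz
    obtain ⟨n, hn, hnU⟩ := hU _ isOpen_interior z hz
    have := hq3 (Nat.pair k n)
    simp only [O, Nat.unpair_pair, mem_ofPred_eq] at this
    obtain ⟨w, hw, hwF⟩ := this ⟨z, hn⟩
    have hw' : w ∈ {z | (q, z) ∈ F k} := interior_subset (hnU hw)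
    exact hwF hw'
  have : ∃ z, z ∉ ⋃ k, {z | (q, z) ∈ F k} := by
    by_contra hcon
    push Not at hcon
    exact not_isMeagre_of_isOpen (X := ℕ → Bool) isOpen_univ ⟨q, mem_univ q⟩
      (hm.mono fun z _ => hcon z)
  obtain ⟨z, hz⟩ := this
  refine ⟨(q, z), hq1, hq2, fun k hk => hz (mem_iUnion.2 ⟨k, hk⟩)⟩

lemma exists_step' (F : ℕ → Set ((ℕ → Bool) × (ℕ → Bool)))
    (C : Set ((ℕ → Bool) × (ℕ → Bool))) (hC : C.Countable) (hCu : ∀ x ∈ C, Unb x.1) :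
    ∃ x : (ℕ → Bool) × (ℕ → Bool), Unb x.1 ∧ (∀ y ∈ C, ∃ k, RR k y.1 x.1) ∧
      (Good F → ∀ k, x ∉ F k) := by
  have key : ∀ F, Good F → ∃ x : (ℕ → Bool) × (ℕ → Bool), Unb x.1 ∧ (∀ y ∈ C, ∃ k, RR k y.1 x.1) ∧
      (∀ k, x ∉ F k) := by
    intro F hF
    rcases C.eq_empty_or_nonempty with rfl | hne
    · obtain ⟨x, h1, -, h3⟩ := exists_step F hF (fun _ _ => true)
        (fun _ N => ⟨N, by simp [cnt]⟩)
      exact ⟨x, h1, by simp, h3⟩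
    · obtain ⟨g, rfl⟩ := hC.exists_eq_range hne
      obtain ⟨x, h1, h2, h3⟩ := exists_step F hF (fun i => (g i).1) (fun i => hCu _ ⟨i, rfl⟩)
      exact ⟨x, h1, by rintro _ ⟨i, rfl⟩; exact h2 i, h3⟩
  by_cases hF : Good F
  · obtain ⟨x, h1, h2, h3⟩ := key F hF
    exact ⟨x, h1, h2, fun _ => h3⟩
  · obtain ⟨x, h1, h2, h3⟩ := key (fun _ => ∅)
      ⟨fun _ => isClosed_empty, fun k s V _ ⟨z, hz⟩ => ⟨z, hz, by simp⟩⟩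
    exact ⟨x, h1, h2, fun h => absurd h hF⟩

lemma exists_homeo : Nonempty ((ℕ → Bool) ≃ₜ (ℕ → Bool) × (ℕ → Bool)) :=
  ⟨(Homeomorph.piCongrLeft (Y := fun _ => Bool) Equiv.natSumNatEquivNat).symm.trans
    Homeomorph.sumArrowHomeomorphProdArrow⟩

lemma exists_recursion (hCH : Cardinal.continuum.{0} = Cardinal.aleph 1)
    (I : Type) (e : I ≃ Set (ℕ × ℕ)) :
    ∃ (_ : LinearOrder I) (a : I → (ℕ → Bool) × (ℕ → Bool)),
      (∀ i : I, (Iio i).Countable) ∧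
      (∀ i j, i < j → ∃ k, RR k (a i).1 (a j).1) ∧
      ∀ F, Good F → ∃ i, ∀ k, a i ∉ F k := by
  obtain ⟨U, hUo, hU⟩ := exists_open_enum ((ℕ → Bool) × (ℕ → Bool))
  obtain ⟨_, _, hord⟩ := Cardinal.exists_ord_eq_type_lt I
  have hct : ∀ i : I, (Iio i).Countable := by
    intro i
    rw [← Cardinal.le_aleph0_iff_set_countable, ← Cardinal.lt_aleph_one_iff, ← hCH]
    have := Cardinal.mk_Iio_lt i hord
    rw [Cardinal.mk_congr e] at this
    simpa using this
  let FF : I → ℕ → Set ((ℕ → Bool) × (ℕ → Bool)) := fun c k =>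
    (⋃ n ∈ {n | (k, n) ∈ e c}, U n)ᶜ
  let W := {x : (ℕ → Bool) × (ℕ → Bool) // Unb x.1}
  have hstep : ∀ (i : I) (prev : ∀ j, j < i → W), ∃ x : W,
      (∀ j (h : j < i), ∃ k, RR k (prev j h).1.1 x.1.1) ∧ (Good (FF i) → ∀ k, x.1 ∉ FF i k) := by
    intro i prev
    have : Countable (Iio i) := (hct i).to_subtype
    obtain ⟨x, h1, h2, h3⟩ := exists_step' (FF i) (range fun j : Iio i => (prev j.1 j.2).1)
      (countable_range _) (by rintro _ ⟨j, rfl⟩; exact (prev j.1 j.2).2)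
    exact ⟨⟨x, h1⟩, fun j h => h2 _ ⟨⟨j, h⟩, rfl⟩, h3⟩
  choose st hst1 hst2 using hstep
  have wf : WellFounded (fun i j : I => i < j) := wellFounded_lt
  let a : I → W := wf.fix st
  have ha : ∀ i, a i = st i (fun j _ => a j) := fun i => wf.fix_eq st i
  refine ⟨inferInstance, fun i => (a i).1, hct, ?_, ?_⟩
  · intro i j hij
    dsimp only
    rw [ha j]
    exact hst1 j (fun j _ => a j) i hij
  · intro F hF
    let c : I := e.symm {kn | U kn.2 ⊆ (F kn.1)ᶜ}
    have hec : e c = {kn | U kn.2 ⊆ (F kn.1)ᶜ} := e.apply_symm_apply _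
    have hc : FF c = F := by
      funext k
      simp only [FF, hec]
      rw [compl_eq_comm]
      apply Subset.antisymm
      · intro x hx
        obtain ⟨n, hn, hn2⟩ := hU _ (hF.1 k).isOpen_compl x hx
        exact mem_biUnion (show n ∈ {n | (k, n) ∈ {kn : ℕ × ℕ | U kn.2 ⊆ (F kn.1)ᶜ}} from hn2) hn
      · exact iUnion₂_subset fun n hn => hn
    refine ⟨c, ?_⟩
    have := hst2 c (fun j _ => a j)
    rw [hc] at this
    dsimp only
    rw [ha c]
    exact this hF

lemma perfect_fiber (h : (ℕ → Bool) ≃ₜ (ℕ → Bool) × (ℕ → Bool)) (d : ℕ → Bool) :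
    PerfectSet {x | (h x).1 = d} := by
  refine ⟨⟨isClosed_eq (by fun_prop) continuous_const, ?_⟩, h.symm (d, d), by simp⟩
  intro x hx
  rw [accPt_iff_frequently]
  have ht : Tendsto (fun k : ℕ => h.symm (d, Function.update (h x).2 k (!(h x).2 k))) atTop (𝓝 x) := by
    have h1 : Tendsto (fun k : ℕ => Function.update (h x).2 k (!(h x).2 k)) atTop (𝓝 (h x).2) := by
      rw [tendsto_pi_nhds]
      intro i
      apply tendsto_const_nhds.congr'
      filter_upwards [eventually_gt_atTop i] with k hk
      rw [Function.update_of_ne hk.ne]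
    have h2 := (h.symm.continuous.tendsto (d, (h x).2)).comp
      ((tendsto_const_nhds (x := d) (f := atTop)).prodMk_nhds h1)
    have h3 : h.symm (d, (h x).2) = x := by
      rw [Homeomorph.symm_apply_eq]
      exact Prod.ext hx.symm rfl
    rw [h3] at h2
    exact h2
  refine ht.frequently (Eventually.of_forall fun k => ⟨?_, by simp⟩).frequently
  intro he
  rw [Homeomorph.symm_apply_eq] at he
  have := congrFun (congrArg Prod.snd he) k
  simp at this

theorem stmt15 (hCH : Cardinal.continuum = Cardinal.aleph 1) :
    ∃ A : Set (ℕ → Bool), UniversallyMeager A ∧ ¬ CPM A := by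
  have hCH0 : Cardinal.continuum.{0} = Cardinal.aleph 1 := by
    apply Cardinal.lift_injective
    simpa using hCH
  obtain ⟨I, ⟨e⟩⟩ : ∃ I : Type, Nonempty (I ≃ Set (ℕ × ℕ)) := ⟨_, ⟨Equiv.refl _⟩⟩
  obtain ⟨_, a, hct, hR, hF⟩ := exists_recursion hCH0 I e
  obtain ⟨h⟩ := exists_homeo
  have hctc : ∀ i : I, (Iic i).Countable := fun i => by
    rw [← Iio_insert]; exact (hct i).insert i
  refine ⟨range fun i => h.symm (a i), ?_, ?_⟩
  · apply um_of_rel _ (fun k x y => RR k (h x).1 (h y).1)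
    · intro k x
      simp only [RR, ofPred_forall]
      refine isClosed_iInter fun m => isClosed_iInter fun _ => ?_
      have hc : Continuous fun y => cnt (h y).1 m :=
        (continuous_cnt m).comp (continuous_fst.comp h.continuous)
      exact (isClosed_discrete (Iio (cnt (h x).1 m))).preimage hc
    · rintro _ ⟨i, rfl⟩
      refine ((hctc i).image fun i => h.symm (a i)).mono ?_
      rintro _ ⟨⟨j, rfl⟩, hj⟩
      refine ⟨j, ?_, rfl⟩
      by_contra hij
      obtain ⟨k, hk⟩ := hR i j (not_le.1 hij)
      exact hj k (by simpa using hk)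
    · rintro _ ⟨i, rfl⟩
      refine ((hctc i).image fun i => h.symm (a i)).mono ?_
      rintro _ ⟨⟨j, rfl⟩, k, hj⟩
      refine ⟨j, ?_, rfl⟩
      by_contra hij
      obtain ⟨l, hl⟩ := hR i j (not_le.1 hij)
      have h1 := hj (max k l) (le_max_left _ _)
      have h2 := hl (max k l) (le_max_right _ _)
      simp only [Homeomorph.apply_symm_apply] at h1
      omega
  · intro hcpm
    obtain ⟨e, he⟩ := exists_surjective_nat (Finset ℕ)
    obtain ⟨F, ⟨s, hs, rfl⟩, hA, hm⟩ := hcpm (fun n => {x | (h x).1 = dd (e n)})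
      (fun n => perfect_fiber h _)
    obtain ⟨i, hi⟩ := hF (fun k => h.symm ⁻¹' (s k)) (by
      refine ⟨fun k => (hs k).preimage h.symm.continuous, ?_⟩
      intro k t V hV hVne
      obtain ⟨n, rfl⟩ := he t
      by_contra hcon
      push Not at hcon
      have hmn := hm n
      have hPc : IsClosed {x | (h x).1 = dd (e n)} := (perfect_fiber h _).1.closed
      have : CompactSpace {x | (h x).1 = dd (e n)} := isCompact_iff_compactSpace.1 hPc.isCompact
      let Q : Set {x | (h x).1 = dd (e n)} := {x | (h x.1).2 ∈ V}
      have hQo : IsOpen Q := hV.preimage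
        (continuous_snd.comp (h.continuous.comp continuous_subtype_val))
      obtain ⟨z, hz⟩ := hVne
      refine not_isMeagre_of_isOpen hQo ⟨⟨h.symm (dd (e n), z), by simp⟩, by simpa [Q] using hz⟩
        (hmn.mono ?_)
      rintro ⟨x, hx⟩ hxQ
      refine mem_iUnion.2 ⟨k, ?_⟩
      have := hcon _ hxQ
      have hx' : h.symm (dd (e n), (h x).2) = x := by
        rw [Homeomorph.symm_apply_eq]
        exact Prod.ext hx.symm rfl
      simpa [hx'] using this)
    obtain ⟨k, hk⟩ := mem_iUnion.1 (hA ⟨i, rfl⟩)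
    exact hi k hk
end
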